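/- arXiv:1706.01782 — 7 statements merged into one kernel-verified Lean document; each statement's English description precedes it below -/
import Mathlib

section
/- Let A ⊆ ℝⁿ be Lebesgue measurable and let x be a density point of A. Then for every ζ ∈ ℝⁿ there exists a family (ζ_x^t)_{t>0} approximating in A the direction ζ at x. Moreover, the approximating points can be chosen jointly in ζ so that the convergence is uniform for 0 < ‖ζ‖ ≤ 1: there is a map (t,ζ) ↦ ζ_x^t(ζ) ∈ ℝⁿ with x + ζ_x^t(ζ) ∈ A for all t > 0 and sup_{0<‖ζ‖≤1} ‖ζ_x^t(ζ) − tζ‖/t → 0 as t ↓ 0. -/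
open MeasureTheory Filter Metric Set Topology

noncomputable section

/-- ℝⁿ as a Euclidean space. -/
abbrev Euc (n : ℕ) := EuclideanSpace ℝ (Fin n)

/-- `x` is a density point of `A`. -/
def DensityPoint {n : ℕ} (A : Set (Euc n)) (x : Euc n) : Prop :=
  Tendsto (fun r : ℝ => volume (A ∩ ball x r) / volume (ball x r)) (𝓝[>] (0:ℝ)) (𝓝 1)

/-- The family `c t` approximates in `A` the direction `ζ` at the point `x`. -/
def ApproxInDir {n : ℕ} (A : Set (Euc n)) (x ζ : Euc n) (c : ℝ → Euc n) : Prop :=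
  (∀ t > (0:ℝ), x + c t ∈ A) ∧
    Tendsto (fun t : ℝ => ‖c t - t • ζ‖ / t) (𝓝[>] (0:ℝ)) (𝓝 0)

/-- `f` is differentiable at `x ∈ A` in direction `ζ` with directional derivative `w`:
for every family approximating in `A` the direction `ζ` at `x`, the difference
quotients converge to `w`. -/
def HasDirDeriv {n : ℕ} {X : Type*} [NormedAddCommGroup X] [NormedSpace ℝ X]
    (A : Set (Euc n)) (f : Euc n → X) (x ζ : Euc n) (w : X) : Prop :=
  ∀ c : ℝ → Euc n, ApproxInDir A x ζ c →
    Tendsto (fun t : ℝ => t⁻¹ • (f (x + c t) - f x)) (𝓝[>] (0:ℝ)) (𝓝 w)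

/-- `A` is dense at `x` in direction `ζ`. -/
def DenseAtDir {n : ℕ} (A : Set (Euc n)) (x ζ : Euc n) : Prop :=
  Tendsto (fun t : ℝ =>
      volume {θ : ℝ | θ ∈ Ioo 0 t ∧ x + θ • ζ ∉ A} / ENNReal.ofReal t)
    (𝓝[>] (0:ℝ)) (𝓝 0)

/-- A set `E` in a metric space is porous. -/
def IsPorous {M : Type*} [MetricSpace M] (E : Set M) : Prop :=
  ∃ Λ > (0:ℝ), ∀ a ∈ E, ∃ x : ℕ → M, Tendsto x atTop (𝓝 a) ∧
    ∀ k : ℕ, x k ≠ a ∧ ball (x k) (Λ * dist a (x k)) ∩ E = ∅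

/-- A set is σ-porous if it is a countable union of porous sets. -/
def IsSigmaPorous {M : Type*} [MetricSpace M] (S : Set M) : Prop :=
  ∃ F : ℕ → Set M, S = ⋃ k, F k ∧ ∀ k, IsPorous (F k)

/-- Near a density point `x` of `A`, every ball of radius `ε * t` centred within distance `R * t`
of `x` meets `A`, once `t` is small enough. -/
theorem DensityPoint.eventually_inter_ball_nonempty {n : ℕ} {A : Set (Euc n)} {x : Euc n}
    (hx : DensityPoint A x) {R ε : ℝ} (hR : 0 ≤ R) (hε : 0 < ε) :
    ∀ᶠ t in 𝓝[>] (0 : ℝ), ∀ ζ : Euc n, ‖ζ‖ ≤ R → (A ∩ ball (x + t • ζ) (ε * t)).Nonempty := by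
  have hRε : 0 < R + ε := by positivity
  have hscale : Tendsto (fun t : ℝ => (R + ε) * t) (𝓝[>] 0) (𝓝[>] 0) := by
    refine tendsto_nhdsWithin_iff.2 ⟨?_, ?_⟩
    · have : Tendsto (fun t : ℝ => (R + ε) * t) (𝓝 0) (𝓝 ((R + ε) * 0)) :=
        (continuous_const.mul continuous_id).tendsto 0
      rw [mul_zero] at this
      exact this.mono_left nhdsWithin_le_nhds
    · filter_upwards [self_mem_nhdsWithin] with t ht
      exact mul_pos hRε ht
  set κ : ENNReal := ENNReal.ofReal ((ε / (R + ε)) ^ Module.finrank ℝ (Euc n)) with hκ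
  have hκ0 : 0 < κ := ENNReal.ofReal_pos.2 (by positivity)
  have hlim := (hx.comp hscale).add_const κ
  have h1 : (1 : ENNReal) < 1 + κ := ENNReal.lt_add_right ENNReal.one_ne_top hκ0.ne'
  filter_upwards [hlim.eventually (lt_mem_nhds h1), self_mem_nhdsWithin] with t ht ht0 ζ hζ
  have ht0 : 0 < t := ht0
  by_contra hempty
  rw [Set.not_nonempty_iff_eq_empty] at hempty
  have hr : 0 < (R + ε) * t := by positivity
  have hsub : ball (x + t • ζ) (ε * t) ⊆ ball x ((R + ε) * t) := by
    apply ball_subset_ball'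
    rw [dist_self_add_left, norm_smul, Real.norm_of_nonneg ht0.le]
    nlinarith
  have hdisj : Disjoint (A ∩ ball x ((R + ε) * t)) (ball (x + t • ζ) (ε * t)) :=
    (Set.disjoint_iff_inter_eq_empty.2 hempty).mono_left inter_subset_left
  have hle : volume (A ∩ ball x ((R + ε) * t)) + volume (ball (x + t • ζ) (ε * t)) ≤
      volume (ball x ((R + ε) * t)) := by
    rw [← measure_union hdisj measurableSet_ball]
    exact measure_mono (union_subset inter_subset_right hsub)
  have hvol : volume (ball (x + t • ζ) (ε * t)) = κ * volume (ball x ((R + ε) * t)) := by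
    have : ε * t = ε / (R + ε) * ((R + ε) * t) := by field_simp
    rw [this, Measure.addHaar_ball_mul_of_pos _ _ (by positivity), hκ,
      Measure.addHaar_ball_center volume x]
  have hpos : volume (ball x ((R + ε) * t)) ≠ 0 := (measure_ball_pos volume x hr).ne'
  have hfin : volume (ball x ((R + ε) * t)) ≠ ⊤ := measure_ball_lt_top.ne
  refine ht.not_ge ?_
  rw [hvol] at hle
  calc volume (A ∩ ball x ((R + ε) * t)) / volume (ball x ((R + ε) * t)) + κ
      = (volume (A ∩ ball x ((R + ε) * t)) + κ * volume (ball x ((R + ε) * t))) /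
          volume (ball x ((R + ε) * t)) := by
        rw [ENNReal.add_div, ENNReal.mul_div_cancel_right hpos hfin]
    _ ≤ 1 := ENNReal.div_le_of_le_mul (by rwa [one_mul])

/-- At a density point, points of `A` approximating all directions can be chosen simultaneously,
uniformly on bounded sets of directions. -/
theorem DensityPoint.exists_uniform_approx {n : ℕ} {A : Set (Euc n)} {x : Euc n}
    (hx : DensityPoint A x) :
    ∃ c : ℝ → Euc n → Euc n, (∀ t > (0 : ℝ), ∀ ζ, x + c t ζ ∈ A) ∧
      ∀ R ≥ (0 : ℝ), ∀ ε > (0 : ℝ), ∀ᶠ t in 𝓝[>] (0 : ℝ), ∀ ζ : Euc n, ‖ζ‖ ≤ R →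
        ‖c t ζ - t • ζ‖ / t < ε := by
  obtain ⟨t₀, ht₀⟩ := (hx.eventually_inter_ball_nonempty le_rfl one_pos).exists
  have hne : A.Nonempty := (ht₀ 0 (by simp)).mono inter_subset_left
  have hex : ∀ (t : ℝ) (ζ : Euc n), ∃ v : Euc n, 0 < t →
      x + v ∈ A ∧ dist (x + t • ζ) (x + v) < infDist (x + t • ζ) A + t ^ 2 := by
    intro t ζ
    by_cases ht : 0 < t
    · obtain ⟨a, ha, hd⟩ := (infDist_lt_iff hne).1
        (lt_add_of_pos_right (infDist (x + t • ζ) A) (pow_pos ht 2))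
      exact ⟨a - x, fun _ => by simpa using ⟨ha, hd⟩⟩
    · exact ⟨0, fun h => absurd h ht⟩
  choose c hc using hex
  refine ⟨c, fun t ht ζ => (hc t ζ ht).1, fun R hR ε hε => ?_⟩
  filter_upwards [hx.eventually_inter_ball_nonempty hR (half_pos hε), self_mem_nhdsWithin,
    mem_nhdsWithin_of_mem_nhds (Iio_mem_nhds (half_pos hε))] with t ht ht0 htε ζ hζ
  have ht0 : 0 < t := ht0
  have htε : t < ε / 2 := htε
  obtain ⟨a, haA, ha⟩ := ht ζ hζ
  have hinf := infDist_le_dist_of_mem (x := x + t • ζ) haA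
  rw [mem_ball, dist_comm] at ha
  have hd := (hc t ζ ht0).2
  rw [dist_add_left, dist_comm, dist_eq_norm] at hd
  rw [div_lt_iff₀ ht0]
  nlinarith

/-- At a density point of a measurable set, every direction can be approximated
inside the set, uniformly for directions of norm at most one. -/
theorem stmt0 {n : ℕ} (A : Set (Euc n)) (hA : NullMeasurableSet A volume)
    (x : Euc n) (hx : DensityPoint A x) :
    (∀ ζ : Euc n, ∃ c : ℝ → Euc n, ApproxInDir A x ζ c) ∧
    ∃ c : ℝ → Euc n → Euc n,
      (∀ t > (0:ℝ), ∀ ζ : Euc n, 0 < ‖ζ‖ → ‖ζ‖ ≤ 1 → x + c t ζ ∈ A) ∧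
      ∀ ε > (0:ℝ), ∃ δ > (0:ℝ), ∀ t : ℝ, 0 < t → t < δ →
        ∀ ζ : Euc n, 0 < ‖ζ‖ → ‖ζ‖ ≤ 1 → ‖c t ζ - t • ζ‖ / t < ε := by
  obtain ⟨c, hcA, hc⟩ := hx.exists_uniform_approx
  refine ⟨fun ζ => ⟨fun t => c t ζ, fun t ht => hcA t ht ζ, ?_⟩,
    c, fun t ht ζ _ _ => hcA t ht ζ, fun ε hε => ?_⟩
  · rw [Metric.tendsto_nhds]
    intro ε hε
    filter_upwards [hc ‖ζ‖ (norm_nonneg ζ) ε hε, self_mem_nhdsWithin] with t ht ht0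
    have ht0 : 0 < t := ht0
    rw [dist_zero_right, Real.norm_of_nonneg (by positivity)]
    exact ht ζ le_rfl
  · obtain ⟨δ, hδ, h⟩ := mem_nhdsGT_iff_exists_Ioo_subset.1 (hc 1 zero_le_one ε hε)
    exact ⟨δ, hδ, fun t ht0 htδ ζ _ hζ => h ⟨ht0, htδ⟩ ζ hζ⟩
end
end

section
/- Let X be a real normed space, A ⊆ ℝⁿ measurable, ζ ∈ ℝⁿ \ {0}, x ∈ A, and suppose A is dense at x in direction ζ. Let f : A → X be Lipschitz. Then: (1) there exists a family (ζ_x^t)_{t>0} approximating in A the direction ζ at x; (2) 0 is an accumulation point of the set A(x,ζ) = {t > 0 : x + tζ ∈ A}; (3) f is differentiable at x in direction ζ if and only if the limit lim_{t↓0, t∈A(x,ζ)} (f(x + tζ) − f(x))/t exists, and in that case this limit equals ∂⁺f(x, ζ). -/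
open MeasureTheory Filter Metric Set Topology

noncomputable section

theorem DenseAtDir.eventually_exists_mem {n : ℕ} {A : Set (Euc n)} {x ζ : Euc n}
    (h : DenseAtDir A x ζ) {ε : ℝ} (hε : 0 < ε) (hε1 : ε < 1) :
    ∀ᶠ t : ℝ in 𝓝[>] 0, ∃ s ∈ Ioo ((1 - ε) * t) t, x + s • ζ ∈ A := by
  have hlt : ∀ᶠ t : ℝ in 𝓝[>] 0,
      volume {θ : ℝ | θ ∈ Ioo 0 t ∧ x + θ • ζ ∉ A} / ENNReal.ofReal t < ENNReal.ofReal ε :=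
    h.eventually (gt_mem_nhds (by simpa using hε))
  filter_upwards [hlt, self_mem_nhdsWithin] with t ht ht0
  have ht0 : 0 < t := ht0
  by_contra! hbad
  have hsub : Ioo ((1 - ε) * t) t ⊆ {θ : ℝ | θ ∈ Ioo 0 t ∧ x + θ • ζ ∉ A} := fun s hs =>
    ⟨⟨(mul_pos (sub_pos.2 hε1) ht0).trans hs.1, hs.2⟩, hbad s hs⟩
  have hvol := measure_mono (μ := volume) hsub
  rw [Real.volume_Ioo, show t - (1 - ε) * t = ε * t by ring, ENNReal.ofReal_mul hε.le] at hvol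
  rw [ENNReal.div_lt_iff (Or.inl (by simpa using ht0)) (Or.inl ENNReal.ofReal_ne_top)] at ht
  exact absurd hvol ht.not_ge

/-- Near-maximal parameters `s t ≤ t` of points of `A` on the ray from `x` in direction `ζ`. -/
theorem DenseAtDir.exists_parameter {n : ℕ} {A : Set (Euc n)} {x ζ : Euc n}
    (h : DenseAtDir A x ζ) (hx : x ∈ A) :
    ∃ s : ℝ → ℝ, (∀ t > 0, x + s t • ζ ∈ A) ∧ (∀ t > 0, x + t • ζ ∈ A → s t = t) ∧
      Tendsto (fun t => s t / t) (𝓝[>] 0) (𝓝 1) := by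
  have hex : ∀ t : ℝ, ∃ s : ℝ, 0 < t → x + s • ζ ∈ A ∧ (x + t • ζ ∈ A → s = t) ∧ s ≤ t ∧
      ∀ r ∈ Ioo 0 t, x + r • ζ ∈ A → r < s + t ^ 2 := by
    intro t
    by_cases htA : x + t • ζ ∈ A
    · exact ⟨t, fun ht => ⟨htA, fun _ => rfl, le_rfl, fun r hr _ => by nlinarith [hr.2]⟩⟩
    by_cases ht : 0 < t
    · have hne : {r : ℝ | r ∈ Icc 0 t ∧ x + r • ζ ∈ A}.Nonempty :=
        ⟨0, ⟨le_rfl, ht.le⟩, by simpa using hx⟩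
      have hbdd : BddAbove {r : ℝ | r ∈ Icc 0 t ∧ x + r • ζ ∈ A} := ⟨t, fun r hr => hr.1.2⟩
      obtain ⟨s, hs, hsup⟩ := exists_lt_of_lt_csSup hne (sub_lt_self _ (pow_pos ht 2))
      refine ⟨s, fun _ => ⟨hs.2, fun hA => absurd hA htA, hs.1.2, fun r hr hrA => ?_⟩⟩
      have := le_csSup hbdd (show r ∈ _ from ⟨Ioo_subset_Icc_self hr, hrA⟩)
      linarith
    · exact ⟨0, fun ht' => absurd ht' ht⟩
  choose s hs using hex
  refine ⟨s, fun t ht => (hs t ht).1, fun t ht => (hs t ht).2.1, ?_⟩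
  refine Metric.tendsto_nhds.2 fun ε hε => ?_
  obtain ⟨δ, hδ, hδε⟩ := exists_between (lt_min (half_pos hε) one_pos)
  obtain ⟨hδε, hδ1⟩ := lt_min_iff.1 hδε
  filter_upwards [h.eventually_exists_mem hδ hδ1, Ioo_mem_nhdsGT (half_pos hε)]
    with t ⟨r, hr, hrA⟩ ⟨ht, htε⟩
  obtain ⟨-, -, hle, hmax⟩ := hs t ht
  have hrs := hmax r ⟨(mul_pos (sub_pos.2 hδ1) ht).trans hr.1, hr.2⟩ hrA
  have hupper : s t / t ≤ 1 := (div_le_one ht).2 hle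
  have hlower : 1 - δ - t < s t / t := by
    rw [lt_div_iff₀ ht]
    nlinarith [hr.1]
  rw [Real.dist_eq, abs_lt]
  constructor <;> linarith

theorem tendsto_norm_smul_sub_div {E : Type*} [NormedAddCommGroup E] [NormedSpace ℝ E]
    {s : ℝ → ℝ} (hs : Tendsto (fun t => s t / t) (𝓝[>] 0) (𝓝 1)) (ζ : E) :
    Tendsto (fun t => ‖s t • ζ - t • ζ‖ / t) (𝓝[>] 0) (𝓝 0) := by
  have hlim : Tendsto (fun t => |s t / t - 1| * ‖ζ‖) (𝓝[>] 0) (𝓝 0) := by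
    simpa using ((hs.sub_const 1).abs.mul_const ‖ζ‖)
  refine hlim.congr' ?_
  filter_upwards [self_mem_nhdsWithin] with t ht
  have ht : 0 < t := ht
  rw [← sub_smul, norm_smul, Real.norm_eq_abs, mul_div_right_comm]
  congr 1
  rw [div_sub_one ht.ne', abs_div, abs_of_pos ht]

theorem tendsto_nhdsGT_zero_of_div {s : ℝ → ℝ}
    (hs : Tendsto (fun t => s t / t) (𝓝[>] 0) (𝓝 1)) :
    Tendsto s (𝓝[>] 0) (𝓝[>] 0) := by
  have hid : Tendsto (fun t : ℝ => t) (𝓝[>] 0) (𝓝 0) := tendsto_nhdsWithin_of_tendsto_nhds tendsto_id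
  refine tendsto_nhdsWithin_iff.2 ⟨?_, ?_⟩
  · have hlim : Tendsto (fun t => s t / t * t) (𝓝[>] 0) (𝓝 0) := by simpa using hs.mul hid
    refine hlim.congr' ?_
    filter_upwards [self_mem_nhdsWithin] with t ht
    exact div_mul_cancel₀ _ (ne_of_gt ht)
  · filter_upwards [hs.eventually (lt_mem_nhds one_pos), self_mem_nhdsWithin] with t hst ht
    exact (div_pos_iff_of_pos_right ht).1 hst

/-- Along two families in `A` differing by `o(t)`, the difference quotients of a Lipschitz
function differ by `o(1)`. -/
theorem LipschitzOnWith.tendsto_inv_smul_sub {E X : Type*} [NormedAddCommGroup E]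
    [NormedAddCommGroup X] [NormedSpace ℝ X] {A : Set E} {f : E → X} {K : NNReal}
    (hf : LipschitzOnWith K f A) {x : E} {c d : ℝ → E}
    (hc : ∀ t > 0, x + c t ∈ A) (hd : ∀ t > 0, x + d t ∈ A)
    (hcd : Tendsto (fun t => ‖c t - d t‖ / t) (𝓝[>] 0) (𝓝 0)) :
    Tendsto (fun t : ℝ => t⁻¹ • (f (x + c t) - f (x + d t))) (𝓝[>] 0) (𝓝 0) := by
  have hlim : Tendsto (fun t => K * (‖c t - d t‖ / t)) (𝓝[>] 0) (𝓝 0) := by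
    simpa using hcd.const_mul (K : ℝ)
  refine squeeze_zero_norm' ?_ hlim
  filter_upwards [self_mem_nhdsWithin] with t ht
  have ht : 0 < t := ht
  have hle := hf.norm_sub_le (hc t ht) (hd t ht)
  rw [add_sub_add_left_eq_sub] at hle
  rw [norm_smul, norm_inv, Real.norm_of_nonneg ht.le, ← mul_div_assoc, inv_mul_eq_div]
  gcongr

/-- If `A` is dense at `x` in direction `ζ` and `f` is Lipschitz, then: (1) there is an
approximating family; (2) `0` is an accumulation point of `{t > 0 : x + tζ ∈ A}`;
(3) `f` is differentiable at `x` in direction `ζ` with derivative `w` iff the difference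
quotients along `{t > 0 : x + tζ ∈ A}` converge to `w`. -/
theorem stmt4 {n : ℕ} {X : Type*} [NormedAddCommGroup X] [NormedSpace ℝ X]
    (A : Set (Euc n)) (hA : NullMeasurableSet A volume)
    (f : Euc n → X) (K : NNReal) (hf : LipschitzOnWith K f A)
    (x : Euc n) (hx : x ∈ A) (ζ : Euc n) (hζ : ζ ≠ 0)
    (hdense : DenseAtDir A x ζ) :
    (∃ c : ℝ → Euc n, ApproxInDir A x ζ c) ∧
    ((0:ℝ) ∈ closure {t : ℝ | 0 < t ∧ x + t • ζ ∈ A}) ∧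
    (∀ w : X, HasDirDeriv A f x ζ w ↔
      Tendsto (fun t : ℝ => t⁻¹ • (f (x + t • ζ) - f x))
        (𝓝[{t : ℝ | 0 < t ∧ x + t • ζ ∈ A}] 0) (𝓝 w)) := by
  obtain ⟨s, hsA, hs_eq, hs_div⟩ := hdense.exists_parameter hx
  have hs_approx : ApproxInDir A x ζ fun t => s t • ζ :=
    ⟨hsA, tendsto_norm_smul_sub_div hs_div ζ⟩
  have hs_zero := tendsto_nhdsGT_zero_of_div hs_div
  have hs_mem : ∀ᶠ t in 𝓝[>] 0, s t ∈ {t : ℝ | 0 < t ∧ x + t • ζ ∈ A} := by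
    filter_upwards [hs_zero.eventually self_mem_nhdsWithin, self_mem_nhdsWithin] with t hst ht
    exact ⟨hst, hsA t ht⟩
  have hs_nhds : Tendsto s (𝓝[>] 0) (𝓝 0) := hs_zero.mono_right nhdsWithin_le_nhds
  refine ⟨⟨_, hs_approx⟩, mem_closure_of_tendsto hs_nhds hs_mem, fun w => ⟨fun hw => ?_, ?_⟩⟩
  · refine ((hw _ hs_approx).mono_left (nhdsWithin_mono 0 fun t ht => ht.1)).congr' ?_
    filter_upwards [self_mem_nhdsWithin] with t ht
    rw [hs_eq t ht.1 ht.2]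
  · intro hw c hc
    have hquot := hs_div.smul (hw.comp (tendsto_nhdsWithin_iff.2 ⟨hs_nhds, hs_mem⟩))
    have hcs : Tendsto (fun t => ‖c t - s t • ζ‖ / t) (𝓝[>] 0) (𝓝 0) := by
      refine squeeze_zero' ?_ ?_ (by simpa using hc.2.add hs_approx.2)
      · filter_upwards [self_mem_nhdsWithin] with t ht
        exact div_nonneg (norm_nonneg _) (le_of_lt ht)
      · filter_upwards [self_mem_nhdsWithin] with t ht
        have ht : 0 < t := ht
        rw [← add_div, norm_sub_rev (s t • ζ)]
        gcongr
        exact norm_sub_le_norm_sub_add_norm_sub _ _ _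
    have hlim := (hf.tendsto_inv_smul_sub hc.1 hsA hcs).add hquot
    rw [zero_add, one_smul] at hlim
    refine hlim.congr' ?_
    filter_upwards [hs_mem] with t hst
    rw [Function.comp_apply, smul_smul, div_mul_eq_mul_div, mul_inv_cancel₀ hst.1.ne', one_div,
      ← smul_add, sub_add_sub_cancel]
end
end

section
/- Let A ⊆ ℝⁿ be Lebesgue measurable, ζ ∈ ℝⁿ \ {0}, and let f : A → ℝ^m be Lipschitz. Then for Lebesgue-almost every x ∈ A: (1) A is dense at x in direction ζ, and (2) f is differentiable at x in direction ζ, i.e. the directional derivative ∂⁺f(x, ζ) exists. -/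
open MeasureTheory Filter Metric Set Topology

noncomputable section

/-- Directional density follows from the decay of the density quotients at dyadic scales. -/
lemma denseAtDir_of_tendsto_dyadic {n : ℕ} {A : Set (Euc n)} {x ζ : Euc n}
    (h : Tendsto (fun k : ℕ => volume {θ : ℝ | θ ∈ Ioo 0 ((1 / 2 : ℝ) ^ k) ∧ x + θ • ζ ∉ A} /
      ENNReal.ofReal ((1 / 2 : ℝ) ^ k)) atTop (𝓝 0)) :
    DenseAtDir A x ζ := by
  have h2 := ENNReal.Tendsto.const_mul (a := 2) h (Or.inr (by simp))
  rw [mul_zero, ENNReal.tendsto_nhds_zero] at h2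
  rw [DenseAtDir, ENNReal.tendsto_nhds_zero]
  intro ε hε
  obtain ⟨N, hN⟩ := eventually_atTop.1 (h2 ε hε)
  filter_upwards [Ioo_mem_nhdsGT (show (0 : ℝ) < (1 / 2) ^ N by positivity)] with t ht
  obtain ⟨k, hk, hk'⟩ := exists_nat_pow_near_of_lt_one ht.1
    (ht.2.le.trans (pow_le_one₀ (by norm_num) (by norm_num))) (y := (1 / 2 : ℝ))
    (by norm_num) (by norm_num)
  have hNk : N ≤ k := by
    have := (pow_lt_pow_iff_right_of_lt_one₀ (a := (1 / 2 : ℝ)) (by norm_num) (by norm_num)).1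
      (hk.trans ht.2)
    omega
  refine le_trans ?_ (hN k hNk)
  calc
    _ ≤ volume {θ : ℝ | θ ∈ Ioo 0 ((1 / 2 : ℝ) ^ k) ∧ x + θ • ζ ∉ A} /
        ENNReal.ofReal ((1 / 2 : ℝ) ^ (k + 1)) := by
      refine ENNReal.div_le_div (measure_mono ?_) (ENNReal.ofReal_le_ofReal hk.le)
      exact fun θ hθ => ⟨⟨hθ.1.1, hθ.1.2.trans_le hk'⟩, hθ.2⟩
    _ = _ := by
      rw [pow_succ, ENNReal.ofReal_mul (by positivity), one_div,
        ENNReal.ofReal_inv_of_pos two_pos, ENNReal.ofReal_ofNat, div_eq_mul_inv, div_eq_mul_inv,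
        ENNReal.mul_inv (Or.inr (by simp)) (Or.inr (by simp)), inv_inv]
      ring

/-- The measure of the complement of `A` along a ray depends measurably on the base point. -/
lemma measurable_volume_ray_inter_compl {n : ℕ} {A : Set (Euc n)} (hA : MeasurableSet A)
    (ζ : Euc n) (t : ℝ) :
    Measurable fun x : Euc n => volume {θ : ℝ | θ ∈ Ioo 0 t ∧ x + θ • ζ ∉ A} := by
  have hm : Measurable fun p : Euc n × ℝ => p.1 + p.2 • ζ := by fun_prop
  have hS : MeasurableSet {p : Euc n × ℝ | p.2 ∈ Ioo 0 t ∧ p.1 + p.2 • ζ ∉ A} :=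
    (measurable_snd measurableSet_Ioo).inter (hm hA.compl)
  exact measurable_measure_prodMk_left hS

/-- Along each line parallel to `ζ`, directional density holds at almost every point of `A`. -/
lemma ae_denseAtDir_line {n : ℕ} {A : Set (Euc n)} (hA : MeasurableSet A) (y ζ : Euc n) :
    ∀ᵐ s : ℝ, y + s • ζ ∈ A → DenseAtDir A (y + s • ζ) ζ := by
  let S : Set ℝ := {s | y + s • ζ ∈ A}
  have hS : MeasurableSet S := (by fun_prop : Measurable fun s : ℝ => y + s • ζ) hA
  filter_upwards [VitaliFamily.ae_tendsto_measure_inter_div_of_measurableSet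
    (IsUnifLocDoublingMeasure.vitaliFamily (volume : Measure ℝ) 1) hS.compl] with s hs hsS
  rw [indicator_of_notMem (show s ∉ Sᶜ from notMem_compl_iff.2 hsS)] at hs
  have hshift : Tendsto (fun t : ℝ => s + t) (𝓝[>] 0) (𝓝[>] s) := by
    refine tendsto_nhdsWithin_iff.2 ⟨?_, ?_⟩
    · have : Tendsto (fun t : ℝ => s + t) (𝓝 0) (𝓝 (s + 0)) := tendsto_id.const_add s
      rw [add_zero] at this
      exact this.mono_left nhdsWithin_le_nhds
    · filter_upwards [self_mem_nhdsWithin] with t ht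
      exact lt_add_of_pos_right s ht
  refine tendsto_of_tendsto_of_tendsto_of_le_of_le tendsto_const_nhds
    (hs.comp ((Real.tendsto_Icc_vitaliFamily_right s).comp hshift)) (fun _ => zero_le) fun t => ?_
  simp only [Function.comp_apply, Real.volume_Icc, add_sub_cancel_left]
  refine ENNReal.div_le_div_right ?_ _
  rw [← measure_preimage_add volume s (Sᶜ ∩ Icc s (s + t))]
  refine measure_mono fun θ hθ => ⟨fun h => hθ.2 ?_, ?_, ?_⟩
  · simpa [S, add_smul, add_assoc] using h
  · linarith [hθ.1.1]
  · linarith [hθ.1.2]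

/-- A measurable set is dense in direction `ζ` at almost every one of its points. -/
lemma ae_denseAtDir_of_measurableSet {n : ℕ} {A : Set (Euc n)} (hA : MeasurableSet A)
    (ζ : Euc n) : ∀ᵐ x : Euc n, x ∈ A → DenseAtDir A x ζ := by
  let D : Set (Euc n) := {x | Tendsto (fun k : ℕ =>
    volume {θ : ℝ | θ ∈ Ioo 0 ((1 / 2 : ℝ) ^ k) ∧ x + θ • ζ ∉ A} /
      ENNReal.ofReal ((1 / 2 : ℝ) ^ k)) atTop (𝓝 0)}
  have hDm : MeasurableSet D := measurableSet_tendsto _ fun k =>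
    (measurable_volume_ray_inter_compl hA ζ _).div_const _
  have hpow : Tendsto (fun k : ℕ => (1 / 2 : ℝ) ^ k) atTop (𝓝[>] 0) :=
    tendsto_pow_atTop_nhdsWithin_zero_of_lt_one (by norm_num) (by norm_num)
  have key := ae_mem_of_ae_add_linearMap_mem (LinearMap.toSpanSingleton ℝ (Euc n) ζ)
    (volume : Measure ℝ) (volume : Measure (Euc n)) (hA.compl.union hDm) (fun y => by
      filter_upwards [ae_denseAtDir_line hA y ζ] with s hs
      rw [LinearMap.toSpanSingleton_apply]
      by_cases h : y + s • ζ ∈ A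
      · exact Or.inr ((hs h).comp hpow)
      · exact Or.inl h)
  filter_upwards [key] with x hx hxA
  exact denseAtDir_of_tendsto_dyadic (hx.resolve_left fun h => h hxA)

/-- Directional density passes to larger sets. -/
lemma DenseAtDir.mono {n : ℕ} {A B : Set (Euc n)} {x ζ : Euc n} (h : DenseAtDir A x ζ)
    (hAB : A ⊆ B) : DenseAtDir B x ζ := by
  refine tendsto_of_tendsto_of_tendsto_of_le_of_le tendsto_const_nhds h (fun _ => zero_le)
    fun t => ENNReal.div_le_div_right (measure_mono ?_) _
  exact fun θ hθ => ⟨hθ.1, fun hA => hθ.2 (hAB hA)⟩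

/-- A Fréchet derivative within `A` yields the directional derivatives. -/
lemma HasFDerivWithinAt.hasDirDeriv {n : ℕ} {X : Type*} [NormedAddCommGroup X]
    [NormedSpace ℝ X] {A : Set (Euc n)} {f : Euc n → X} {x : Euc n} {L : Euc n →L[ℝ] X}
    (h : HasFDerivWithinAt f L A x) (ζ : Euc n) : HasDirDeriv A f x ζ (L ζ) := by
  rintro c ⟨hcA, hc⟩
  have hquot : Tendsto (fun t : ℝ => t⁻¹ • c t) (𝓝[>] 0) (𝓝 ζ) := by
    rw [tendsto_iff_norm_sub_tendsto_zero]
    refine hc.congr' ?_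
    filter_upwards [self_mem_nhdsWithin] with t ht
    have ht : 0 < t := ht
    have : t⁻¹ • c t - ζ = t⁻¹ • (c t - t • ζ) := by
      rw [smul_sub, inv_smul_smul₀ ht.ne']
    rw [this, norm_smul, norm_inv, Real.norm_of_nonneg ht.le, div_eq_inv_mul]
  have hid : Tendsto (fun t : ℝ => t) (𝓝[>] 0) (𝓝 0) := nhdsWithin_le_nhds
  refine h.lim ?_ ?_ hquot
  · have := hid.smul hquot
    rw [zero_smul] at this
    refine this.congr' ?_
    filter_upwards [self_mem_nhdsWithin] with t ht
    exact smul_inv_smul₀ (ne_of_gt ht) _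
  · filter_upwards [self_mem_nhdsWithin] with t ht using hcA t ht

/-- A Lipschitz map on a measurable subset of ℝⁿ with values in ℝᵐ is, at almost
every point of its domain, directionally differentiable in any fixed nonzero
direction, in which the domain is moreover dense. -/
theorem stmt6 {n m : ℕ} (A : Set (Euc n)) (hA : NullMeasurableSet A volume)
    (ζ : Euc n) (hζ : ζ ≠ 0)
    (f : Euc n → Euc m) (K : NNReal) (hf : LipschitzOnWith K f A) :
    ∀ᵐ x ∂(volume : Measure (Euc n)), x ∈ A →
      DenseAtDir A x ζ ∧ ∃ w : Euc m, HasDirDeriv A f x ζ w := by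
  obtain ⟨B, hBA, hB, hBae⟩ := hA.exists_measurable_subset_ae_eq
  filter_upwards [ae_denseAtDir_of_measurableSet hB ζ, hBae.mem_iff,
    hf.ae_differentiableWithinAt_of_mem (μ := volume)] with x hdense hmem hdiff hxA
  exact ⟨(hdense (hmem.2 hxA)).mono hBA, _, (hdiff hxA).hasFDerivWithinAt.hasDirDeriv ζ⟩
end
end

section
/- Let X be a real normed space, A ⊆ ℝⁿ measurable, and f : A → X Lipschitz with Lipschitz constant L > 0. Fix ζ, η ∈ ℝⁿ, y, z ∈ X and ε, δ > 0, and let P be the set of points p ∈ A with the following two properties. (i) For all 0 < t < δ there exist ζ_p^t, η_p^t ∈ ℝⁿ satisfying p + ζ_p^t ∈ A, ‖ζ_p^t − tζ‖ < εt, ‖f(p + ζ_p^t) − f(p) − ty‖ ≤ εt, and p + η_p^t ∈ A, ‖η_p^t − tη‖ < εt, ‖f(p + η_p^t) − f(p) − tz‖ ≤ εt. (ii) For arbitrarily small t > 0 there exists ω_p^t ∈ ℝⁿ with p + ω_p^t ∈ A, ‖ω_p^t − t(ζ + η)‖ < εt, and ‖f(p + ω_p^t) − f(p) − t(y + z)‖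 > (4 + 3L)εt. Then P is a porous subset of ℝⁿ. -/
open MeasureTheory Filter Metric Set Topology

noncomputable section

/-- If `p` and `q` are points at which increments of `f` in directions close to `tζ` and `tη`
are close to `ty` and `tz`, and `q` is close to `p + tζ`, then increments of `f` at `p` in directions
close to `t(ζ + η)` are close to `t(y + z)`. -/
theorem norm_increment_add_le {E X : Type*} [SeminormedAddCommGroup E] [NormedSpace ℝ E]
    [SeminormedAddCommGroup X] [NormedSpace ℝ X] {A : Set E} {f : E → X} {L : NNReal}
    (hf : LipschitzOnWith L f A) {ζ η p q u v w : E} {y z : X} {t a r : ℝ}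
    (hq : q ∈ A) (hu : p + u ∈ A) (hv : q + v ∈ A) (hw : p + w ∈ A)
    (hua : ‖u - t • ζ‖ ≤ a) (hva : ‖v - t • η‖ ≤ a) (hwa : ‖w - t • (ζ + η)‖ ≤ a)
    (hfu : ‖f (p + u) - f p - t • y‖ ≤ a) (hfv : ‖f (q + v) - f q - t • z‖ ≤ a)
    (hqr : ‖q - (p + t • ζ)‖ ≤ r) :
    ‖f (p + w) - f p - t • (y + z)‖ ≤ 2 * a + L * (2 * r + 3 * a) := by
  have h₁ : ‖f q - f (p + u)‖ ≤ L * (r + a) := by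
    refine (hf.norm_sub_le hq hu).trans (mul_le_mul_of_nonneg_left ?_ L.coe_nonneg)
    calc ‖q - (p + u)‖ = ‖(q - (p + t • ζ)) - (u - t • ζ)‖ := by congr 1; abel
      _ ≤ r + a := norm_sub_le_of_le hqr hua
  have h₂ : ‖f (p + w) - f (q + v)‖ ≤ L * (a + r + a) := by
    refine (hf.norm_sub_le hw hv).trans (mul_le_mul_of_nonneg_left ?_ L.coe_nonneg)
    calc ‖p + w - (q + v)‖
        = ‖(w - t • (ζ + η)) - (q - (p + t • ζ)) - (v - t • η)‖ := by
          congr 1; rw [smul_add]; abel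
      _ ≤ a + r + a := norm_sub_le_of_le (norm_sub_le_of_le hwa hqr) hva
  calc ‖f (p + w) - f p - t • (y + z)‖
      = ‖(f (p + w) - f (q + v)) + (f (q + v) - f q - t • z) + (f q - f (p + u))
          + (f (p + u) - f p - t • y)‖ := by congr 1; rw [smul_add]; abel
    _ ≤ L * (a + r + a) + a + L * (r + a) + a :=
        norm_add_le_of_le (norm_add_le_of_le (norm_add_le_of_le h₂ hfv) h₁) hfu
    _ = 2 * a + L * (2 * r + 3 * a) := by ring

/-- A set is porous if near each of its points `p` it misses balls of radius `r * t` around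
`p + t • ζ` for arbitrarily small `t`. -/
theorem isPorous_of_ball_add_smul {E : Type*} [NormedAddCommGroup E] [NormedSpace ℝ E]
    {P : Set E} {ζ : E} {r : ℝ} (hr : 0 < r)
    (h : ∀ p ∈ P, ∀ δ > (0 : ℝ), ∃ t, 0 < t ∧ t < δ ∧ ball (p + t • ζ) (r * t) ∩ P = ∅) :
    IsPorous P := by
  have hζ : 0 < ‖ζ‖ + 1 := by positivity
  refine ⟨r / (‖ζ‖ + 1), by positivity, fun p hp ↦ ?_⟩
  choose t ht₀ ht hball using fun k : ℕ ↦ h p hp (1 / ((k : ℝ) + 1)) Nat.one_div_pos_of_nat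
  have htend : Tendsto t atTop (𝓝 0) :=
    squeeze_zero (fun k ↦ (ht₀ k).le) (fun k ↦ (ht k).le) tendsto_one_div_add_atTop_nhds_zero_nat
  refine ⟨fun k ↦ p + t k • ζ, by simpa using (htend.smul_const ζ).const_add p, fun k ↦ ⟨?_, ?_⟩⟩
  · intro (heq : p + t k • ζ = p)
    have hmem : p ∈ ball (p + t k • ζ) (r * t k) ∩ P :=
      ⟨by rw [heq]; exact mem_ball_self (mul_pos hr (ht₀ k)), hp⟩
    simp [hball k] at hmem
  · refine subset_empty_iff.mp <| (inter_subset_inter_left P <| ball_subset_ball ?_).trans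
      (hball k).subset
    rw [dist_self_add_right, norm_smul, Real.norm_of_nonneg (ht₀ k).le, div_mul_eq_mul_div,
      div_le_iff₀ hζ]
    nlinarith [mul_pos hr (ht₀ k)]

/-- The set of points where the directional derivatives in directions `ζ`, `η` look
like `y`, `z` at all scales below `δ` with accuracy `ε`, but the derivative in
direction `ζ + η` fails to look like `y + z` at arbitrarily small scales, is porous. -/
theorem stmt8 {n : ℕ} {X : Type*} [NormedAddCommGroup X] [NormedSpace ℝ X]
    (A : Set (Euc n)) (hA : NullMeasurableSet A volume)
    (f : Euc n → X) (L : NNReal) (hL : 0 < (L:ℝ)) (hf : LipschitzOnWith L f A)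
    (ζ η : Euc n) (y z : X) (ε δ : ℝ) (hε : 0 < ε) (hδ : 0 < δ) :
    IsPorous {p : Euc n | p ∈ A ∧
      (∀ t : ℝ, 0 < t → t < δ →
        ∃ ζp ηp : Euc n,
          (p + ζp ∈ A ∧ ‖ζp - t • ζ‖ < ε * t ∧ ‖f (p + ζp) - f p - t • y‖ ≤ ε * t) ∧
          (p + ηp ∈ A ∧ ‖ηp - t • η‖ < ε * t ∧ ‖f (p + ηp) - f p - t • z‖ ≤ ε * t)) ∧
      (∀ δ' > (0:ℝ), ∃ t : ℝ, 0 < t ∧ t < δ' ∧ ∃ ωp : Euc n,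
        p + ωp ∈ A ∧ ‖ωp - t • (ζ + η)‖ < ε * t ∧
        (4 + 3 * (L:ℝ)) * ε * t < ‖f (p + ωp) - f p - t • (y + z)‖)} := by
  refine isPorous_of_ball_add_smul (ζ := ζ) (div_pos hε hL) ?_
  rintro p ⟨-, hp, hp'⟩ δ' hδ'
  obtain ⟨t, ht₀, ht, w, hw, hwε, hfw⟩ := hp' (min δ δ') (lt_min hδ hδ')
  refine ⟨t, ht₀, ht.trans_le (min_le_right _ _), eq_empty_iff_forall_notMem.mpr ?_⟩
  rintro q ⟨hqp, hqA, hq, -⟩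
  have htδ : t < δ := ht.trans_le (min_le_left _ _)
  obtain ⟨u, -, ⟨hu, huε, hfu⟩, -⟩ := hp t ht₀ htδ
  obtain ⟨-, v, -, hv, hvε, hfv⟩ := hq t ht₀ htδ
  have hle := norm_increment_add_le hf hqA hu hv hw huε.le hvε.le hwε.le hfu hfv
    (mem_ball_iff_norm.mp hqp).le
  have hr : (L : ℝ) * (ε / L * t) = ε * t := by field_simp
  linarith
end
end

section
/- Let X be a real normed space, A ⊆ ℝⁿ Lebesgue measurable and f : A → X Lipschitz. Then there exists a σ-porous set P ⊆ ℝⁿ such that for every x ∈ A ∩ D(A) \ P the following holds: if the directional derivatives ∂⁺f(x, ζ) and ∂⁺f(x, η) exist for some ζ, η ∈ ℝⁿ \ {0}, then for every a, b > 0 the directional derivative ∂⁺f(x, aζ + bη) exists and ∂⁺f(x, aζ + bη) = a·∂⁺f(x, ζ) + b·∂⁺f(x, η). -/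
open MeasureTheory Filter Metric Set Topology

noncomputable section

/-- `E` is porous at `a` with constant `Λ`. -/
def PorousAt {M : Type*} [MetricSpace M] (E : Set M) (Λ : ℝ) (a : M) : Prop :=
  ∀ δ > (0:ℝ), ∃ y : M, y ≠ a ∧ dist y a < δ ∧ ball y (Λ * dist a y) ∩ E = ∅

lemma isPorous_setOf_porousAt {M : Type*} [MetricSpace M] (E : Set M) {Λ : ℝ} (hΛ : 0 < Λ) :
    IsPorous {a | a ∈ E ∧ PorousAt E Λ a} := by
  refine ⟨Λ, hΛ, fun a ha => ?_⟩
  choose y hne hlt hdisj using fun k : ℕ => ha.2 (1 / ((k : ℝ) + 1)) (by positivity)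
  refine ⟨y, ?_, fun k => ⟨hne k, ?_⟩⟩
  · rw [tendsto_iff_dist_tendsto_zero]
    exact squeeze_zero (fun _ => dist_nonneg) (fun k => (hlt k).le)
      tendsto_one_div_add_atTop_nhds_zero_nat
  · exact subset_empty_iff.1 fun z hz => (hdisj k).subset ⟨hz.1, hz.2.1⟩

lemma isSigmaPorous_setOf_porousAt {M : Type*} [MetricSpace M] {ι : Type*} [Countable ι]
    [Nonempty ι] (E : ι → Set M) :
    IsSigmaPorous {a | ∃ i, ∃ k : ℕ, a ∈ E i ∧ PorousAt (E i) (1 / ((k : ℝ) + 1)) a} := by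
  obtain ⟨e, he⟩ := exists_surjective_nat (ι × ℕ)
  refine ⟨fun m => {a | a ∈ E (e m).1 ∧ PorousAt (E (e m).1) (1 / (((e m).2 : ℝ) + 1)) a},
    ?_, fun m => isPorous_setOf_porousAt _ (by positivity)⟩
  ext a
  simp only [mem_ofPred_eq, mem_iUnion]
  constructor
  · rintro ⟨i, k, h⟩
    obtain ⟨m, hm⟩ := he (i, k)
    exact ⟨m, by rw [hm]; exact h⟩
  · rintro ⟨m, h⟩
    exact ⟨_, _, h⟩

/-- A set which is not porous at one of its points contains approximations of every direction. -/
lemma exists_approxInDir {n : ℕ} {E : Set (Euc n)} {x : Euc n} (hx : x ∈ E)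
    (hE : ∀ k : ℕ, ¬ PorousAt E (1 / ((k : ℝ) + 1)) x) {ζ : Euc n} (hζ : ζ ≠ 0) :
    ∃ c, ApproxInDir E x ζ c := by
  have hex : ∀ t : ℝ, ∃ v : Euc n, 0 < t →
      x + v ∈ E ∧ ‖v - t • ζ‖ < infDist (x + t • ζ) E + t ^ 2 := by
    intro t
    by_cases ht : 0 < t
    · obtain ⟨y, hy, hlt⟩ := (infDist_lt_iff (x := x + t • ζ) ⟨x, hx⟩).1
        (show infDist (x + t • ζ) E < infDist (x + t • ζ) E + t ^ 2 by
          have := pow_pos ht 2; linarith)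
      refine ⟨y - x, fun _ => ⟨by simpa using hy, ?_⟩⟩
      rw [dist_comm, dist_eq_norm] at hlt
      rwa [sub_sub]
    · exact ⟨0, fun h => absurd h ht⟩
  choose c hc using hex
  refine ⟨c, fun t ht => (hc t ht).1, ?_⟩
  rw [Metric.tendsto_nhds]
  intro ε hε
  have hζ' : 0 < ‖ζ‖ := norm_pos_iff.2 hζ
  obtain ⟨k, hk⟩ := exists_nat_one_div_lt (show 0 < ε / 2 / ‖ζ‖ by positivity)
  have hnp := hE k
  simp only [PorousAt, not_forall, not_exists, not_and] at hnp
  obtain ⟨δ, hδ, hnp⟩ := hnp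
  filter_upwards [self_mem_nhdsWithin,
    mem_nhdsWithin_of_mem_nhds (Iio_mem_nhds (show 0 < δ / ‖ζ‖ by positivity)),
    mem_nhdsWithin_of_mem_nhds (Iio_mem_nhds (show 0 < ε / 2 by positivity))] with t ht htδ htε
  simp only [mem_Ioi, mem_Iio] at ht htδ htε
  have hdist : dist (x + t • ζ) x = t * ‖ζ‖ := by
    rw [dist_eq_norm, add_sub_cancel_left, norm_smul, Real.norm_of_nonneg ht.le]
  have hne := hnp (x + t • ζ) (by simp [ht.ne', hζ]) (by rw [hdist]; exact (lt_div_iff₀ hζ').1 htδ)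
  obtain ⟨y, hyb, hyE⟩ := nonempty_iff_ne_empty.2 hne
  rw [mem_ball, dist_comm, dist_comm x, hdist] at hyb
  have h1 : infDist (x + t • ζ) E < ε / 2 * t := by
    calc infDist (x + t • ζ) E ≤ dist (x + t • ζ) y := infDist_le_dist_of_mem hyE
      _ < 1 / ((k : ℝ) + 1) * (t * ‖ζ‖) := hyb
      _ ≤ ε / 2 / ‖ζ‖ * (t * ‖ζ‖) := by gcongr
      _ = ε / 2 * t := by field_simp
  have h2 := (hc t ht).2
  rw [Real.dist_eq, sub_zero, abs_of_nonneg (by positivity), div_lt_iff₀ ht]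
  nlinarith

/-- A directional derivative is attained uniformly in a cone around the direction. -/
lemma HasDirDeriv.exists_uniform {n : ℕ} {X : Type*} [NormedAddCommGroup X] [NormedSpace ℝ X]
    {A : Set (Euc n)} {f : Euc n → X} {x η : Euc n} {w : X} (h : HasDirDeriv A f x η w)
    {c : ℝ → Euc n} (hc : ApproxInDir A x η c) {ε : ℝ} (hε : 0 < ε) :
    ∃ k : ℕ, ∀ t : ℝ, 0 < t → t < 1 / ((k : ℝ) + 1) → ∀ y ∈ A,
      ‖y - x - t • η‖ ≤ 1 / ((k : ℝ) + 1) * t → ‖f y - f x - t • w‖ ≤ ε * t := by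
  classical
  by_contra! hcon
  choose t ht htk y hyA hy hbad using hcon
  let d : ℝ → Euc n := fun s => if hs : ∃ k, t k = s then y hs.choose - x else c s
  have hd : ApproxInDir A x η d := by
    refine ⟨fun s hs => ?_, ?_⟩
    · by_cases h' : ∃ k, t k = s
      · simp only [d, dif_pos h', add_sub_cancel]
        exact hyA _
      · simp only [d, dif_neg h']
        exact hc.1 s hs
    · rw [Metric.tendsto_nhds]
      intro θ hθ
      obtain ⟨N, hN⟩ := exists_nat_one_div_lt hθ
      have hfin : ∀ᶠ s in 𝓝[>] (0:ℝ), ∀ k ∈ Finset.range N, t k ≠ s := by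
        rw [Filter.eventually_all_finset]
        intro k _
        filter_upwards [mem_nhdsWithin_of_mem_nhds (Iio_mem_nhds (ht k))] with s hs
        exact (mem_Iio.1 hs).ne'
      filter_upwards [hfin, self_mem_nhdsWithin, Metric.tendsto_nhds.1 hc.2 θ hθ] with s hs hs0 hcs
      by_cases h' : ∃ k, t k = s
      · have hk := h'.choose_spec
        have hNk : N ≤ h'.choose := by
          by_contra! hlt
          exact hs _ (Finset.mem_range.2 hlt) hk
        have hb := hy h'.choose
        rw [hk] at hb
        have hs0' : 0 < s := hs0
        simp only [d, dif_pos h']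
        rw [Real.dist_eq, sub_zero, abs_of_nonneg (by positivity), div_lt_iff₀ hs0']
        refine hb.trans_lt (mul_lt_mul_of_pos_right (lt_of_le_of_lt ?_ hN) hs0')
        exact Nat.one_div_le_one_div hNk
      · simpa only [d, dif_neg h'] using hcs
  have ht0 : Tendsto t atTop (𝓝[>] (0:ℝ)) :=
    tendsto_nhdsWithin_iff.2 ⟨squeeze_zero (fun k => (ht k).le) (fun k => (htk k).le)
      tendsto_one_div_add_atTop_nhds_zero_nat, Eventually.of_forall ht⟩
  obtain ⟨s, hs, m, hm⟩ : ∃ s, ‖s⁻¹ • (f (x + d s) - f x) - w‖ < ε ∧ ∃ k, t k = s := by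
    obtain ⟨k, hk⟩ := (ht0.eventually (Metric.tendsto_nhds.1 (h d hd) ε hε)).exists
    exact ⟨t k, by rwa [dist_eq_norm] at hk, k, rfl⟩
  have h' : ∃ k, t k = s := ⟨m, hm⟩
  have hk := h'.choose_spec
  have hb := hbad h'.choose
  have hs0 : 0 < s := hk ▸ ht _
  simp only [d, dif_pos h', add_sub_cancel] at hs
  rw [hk] at hb
  refine absurd hb (not_lt.2 ?_)
  have : f (y h'.choose) - f x - s • w = s • (s⁻¹ • (f (y h'.choose) - f x) - w) := by
    rw [smul_sub, smul_inv_smul₀ hs0.ne']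
  rw [this, norm_smul, Real.norm_of_nonneg hs0.le, mul_comm]
  gcongr

lemma HasDirDeriv.pos_smul {n : ℕ} {X : Type*} [NormedAddCommGroup X] [NormedSpace ℝ X]
    {A : Set (Euc n)} {f : Euc n → X} {x ζ : Euc n} {w : X} (h : HasDirDeriv A f x ζ w)
    {a : ℝ} (ha : 0 < a) : HasDirDeriv A f x (a • ζ) (a • w) := by
  intro c hc
  have hscale : ∀ b : ℝ, 0 < b → Tendsto (fun t : ℝ => b * t) (𝓝[>] 0) (𝓝[>] 0) := by
    intro b hb
    refine tendsto_nhdsWithin_iff.2 ⟨?_, ?_⟩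
    · exact ((continuous_const_mul b).tendsto' 0 0 (by simp)).mono_left nhdsWithin_le_nhds
    · filter_upwards [self_mem_nhdsWithin] with t ht
      exact mul_pos hb ht
  have hd : ApproxInDir A x ζ (fun s => c (a⁻¹ * s)) := by
    refine ⟨fun s hs => hc.1 _ (by positivity), ?_⟩
    have := (hc.2.comp (hscale a⁻¹ (inv_pos.2 ha))).const_mul a⁻¹
    rw [mul_zero] at this
    refine this.congr fun s => ?_
    have : (a⁻¹ * s) • a • ζ = s • ζ := by
      rw [smul_smul]; congr 1; field_simp
    simp only [Function.comp_apply, this]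
    field_simp
  refine (((h _ hd).comp (hscale a ha)).const_smul a).congr fun t => ?_
  simp only [Function.comp_apply, inv_mul_cancel_left₀ ha.ne', smul_smul]
  congr 1
  field_simp

/-- The points of `A` at which the increments of `f` in directions `r`-close to `v` are
`ε`-close to `u` at all scales below `r`. -/
def coneSet {n : ℕ} {X : Type*} [NormedAddCommGroup X] [NormedSpace ℝ X]
    (A : Set (Euc n)) (f : Euc n → X) (v : Euc n) (u : X) (ε r : ℝ) : Set (Euc n) :=
  {x | x ∈ A ∧ ∀ t : ℝ, 0 < t → t < r → ∀ y ∈ A,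
    ‖y - x - t • v‖ ≤ r * t → ‖f y - f x - t • u‖ ≤ ε * t}

/-- If `x` lies in cone sets with arbitrarily good constants and those are approximable in the
direction `ζ` at `x`, then directional derivatives at `x` can be added. -/
lemma hasDirDeriv_add_of_coneSet {n : ℕ} {X : Type*} [NormedAddCommGroup X] [NormedSpace ℝ X]
    {A : Set (Euc n)} {f : Euc n → X} {x ζ η : Euc n} {wζ wη : X}
    (hζ : HasDirDeriv A f x ζ wζ)
    (hη : ∀ ε > (0:ℝ), ∃ (v : Euc n) (u : X) (r : ℝ), 0 < r ∧ ‖v - η‖ ≤ r / 2 ∧ ‖u - wη‖ < ε ∧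
      ∃ c, ApproxInDir (coneSet A f v u ε r) x ζ c) :
    HasDirDeriv A f x (ζ + η) (wζ + wη) := by
  intro c hc
  rw [Metric.tendsto_nhds]
  intro ε hε
  obtain ⟨v, u, r, hr, hv, hu, d, hd⟩ := hη (ε / 3) (by positivity)
  have hdA : ApproxInDir A x ζ d := ⟨fun t ht => (hd.1 t ht).1, hd.2⟩
  filter_upwards [self_mem_nhdsWithin, mem_nhdsWithin_of_mem_nhds (Iio_mem_nhds hr),
    Metric.tendsto_nhds.1 hc.2 (r / 4) (by positivity),
    Metric.tendsto_nhds.1 hd.2 (r / 4) (by positivity),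
    Metric.tendsto_nhds.1 (hζ d hdA) (ε / 3) (by positivity)] with t ht htr h1 h2 h3
  have ht : 0 < t := ht
  rw [Real.dist_eq, sub_zero, abs_of_nonneg (by positivity), div_lt_iff₀ ht] at h1 h2
  have hcone := (hd.1 t ht).2 t ht htr (x + c t) (hc.1 t ht) (by
    have heq : x + c t - (x + d t) - t • v =
        (c t - t • (ζ + η)) - (d t - t • ζ) - t • (v - η) := by
      simp only [smul_add, smul_sub]; abel
    rw [heq]
    have h4 : ‖t • (v - η)‖ ≤ r / 2 * t := by
      rw [norm_smul, Real.norm_of_nonneg ht.le, mul_comm]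
      gcongr
    have h5 := norm_sub_le (c t - t • (ζ + η)) (d t - t • ζ)
    have h6 := norm_sub_le ((c t - t • (ζ + η)) - (d t - t • ζ)) (t • (v - η))
    linarith)
  rw [dist_eq_norm] at h3 ⊢
  have heq : t⁻¹ • (f (x + c t) - f x) - (wζ + wη) =
      (t⁻¹ • (f (x + d t) - f x) - wζ) + t⁻¹ • (f (x + c t) - f (x + d t) - t • u)
        + (u - wη) := by
    simp only [smul_sub, inv_smul_smul₀ ht.ne']; abel
  have h7 : ‖t⁻¹ • (f (x + c t) - f (x + d t) - t • u)‖ ≤ ε / 3 := by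
    rw [norm_smul, norm_inv, Real.norm_of_nonneg ht.le, inv_mul_le_iff₀ ht, mul_comm t]
    exact hcone
  rw [heq]
  refine (norm_add₃_le).trans_lt ?_
  linarith

lemma HasDirDeriv.mem_closure_span {n : ℕ} {X : Type*} [NormedAddCommGroup X] [NormedSpace ℝ X]
    {A : Set (Euc n)} {f : Euc n → X} {x η : Euc n} {w : X} (h : HasDirDeriv A f x η w)
    (hx : x ∈ A) {c : ℝ → Euc n} (hc : ApproxInDir A x η c) :
    w ∈ closure (Submodule.span ℝ (f '' A) : Set X) := by
  refine mem_closure_of_tendsto (h c hc) ?_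
  filter_upwards [self_mem_nhdsWithin] with t ht
  exact Submodule.smul_mem _ _ (Submodule.sub_mem _
    (Submodule.subset_span (mem_image_of_mem f (hc.1 t ht)))
    (Submodule.subset_span (mem_image_of_mem f hx)))

lemma HasDirDeriv.exists_mem_coneSet {n : ℕ} {X : Type*} [NormedAddCommGroup X]
    [NormedSpace ℝ X] {A : Set (Euc n)} {f : Euc n → X} {x η : Euc n} {w : X}
    (h : HasDirDeriv A f x η w) (hx : x ∈ A) {c : ℝ → Euc n} (hc : ApproxInDir A x η c)
    {D : Set X} (hD : w ∈ closure D) {V : ℕ → Euc n} (hV : DenseRange V) {ε : ℝ} (hε : 0 < ε) :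
    ∃ j k : ℕ, ∃ u ∈ D, ‖V j - η‖ ≤ 1 / ((k : ℝ) + 1) / 2 ∧ ‖u - w‖ < ε ∧
      x ∈ coneSet A f (V j) u ε (1 / ((k : ℝ) + 1)) := by
  obtain ⟨m, hm⟩ := h.exists_uniform hc (half_pos hε)
  obtain ⟨u, huD, hu⟩ := Metric.mem_closure_iff.1 hD (ε / 2) (half_pos hε)
  rw [dist_comm, dist_eq_norm] at hu
  obtain ⟨k, hk⟩ : ∃ k : ℕ, 1 / ((k : ℝ) + 1) < 1 / ((m : ℝ) + 1) / 2 :=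
    exists_nat_one_div_lt (by positivity)
  obtain ⟨j, hj⟩ := Metric.denseRange_iff.1 hV η (1 / ((k : ℝ) + 1) / 2) (by positivity)
  rw [dist_comm, dist_eq_norm] at hj
  have hk0 : 0 < 1 / ((k : ℝ) + 1) := by positivity
  refine ⟨j, k, u, huD, hj.le, by linarith, hx, fun t ht htk y hy hyt => ?_⟩
  have h1 : ‖t • (V j - η)‖ ≤ 1 / ((k : ℝ) + 1) / 2 * t := by
    rw [norm_smul, Real.norm_of_nonneg ht.le, mul_comm]
    gcongr
  have h2 := hm t ht (by linarith) y hy (by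
    have heq : y - x - t • η = (y - x - t • V j) + t • (V j - η) := by
      rw [smul_sub]; abel
    rw [heq]
    refine (norm_add_le _ _).trans ?_
    nlinarith)
  have h3 : ‖t • (u - w)‖ ≤ ε / 2 * t := by
    rw [norm_smul, Real.norm_of_nonneg ht.le, mul_comm]
    gcongr
  have heq : f y - f x - t • u = (f y - f x - t • w) - t • (u - w) := by
    rw [smul_sub]; abel
  rw [heq]
  refine (norm_sub_le _ _).trans ?_
  linarith

/-- Outside a σ-porous set, directional derivatives of a Lipschitz map act linearly
at density points of the domain. -/
theorem stmt9 {n : ℕ} {X : Type*} [NormedAddCommGroup X] [NormedSpace ℝ X]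
    (A : Set (Euc n)) (hA : NullMeasurableSet A volume)
    (f : Euc n → X) (K : NNReal) (hf : LipschitzOnWith K f A) :
    ∃ P : Set (Euc n), IsSigmaPorous P ∧
      ∀ x : Euc n, x ∈ A → DensityPoint A x → x ∉ P →
        ∀ ζ η : Euc n, ζ ≠ 0 → η ≠ 0 → ∀ wζ wη : X,
          HasDirDeriv A f x ζ wζ → HasDirDeriv A f x η wη →
            ∀ a b : ℝ, 0 < a → 0 < b →
              HasDirDeriv A f x (a • ζ + b • η) (a • wζ + b • wη) := by
  obtain ⟨D, hDc, hD⟩ : TopologicalSpace.IsSeparable (Submodule.span ℝ (f '' A) : Set X) :=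
    (hf.continuousOn.isSeparable_image (TopologicalSpace.IsSeparable.of_separableSpace A)).span
  have := hDc.to_subtype
  let V := TopologicalSpace.denseSeq (Euc n)
  let E : Option (ℕ × D × ℕ × ℕ) → Set (Euc n) := fun i =>
    i.elim A fun p => coneSet A f (V p.1) p.2.1 (1 / ((p.2.2.1 : ℝ) + 1)) (1 / ((p.2.2.2 : ℝ) + 1))
  refine ⟨_, isSigmaPorous_setOf_porousAt E, ?_⟩
  intro x hxA _ hxP ζ η hζ hη wζ wη hwζ hwη a b ha hb
  simp only [mem_ofPred_eq, not_exists, not_and] at hxP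
  have haζ : a • ζ ≠ 0 := smul_ne_zero ha.ne' hζ
  have hbη : b • η ≠ 0 := smul_ne_zero hb.ne' hη
  have hwη' := hwη.pos_smul hb
  obtain ⟨c, hc⟩ := exists_approxInDir hxA (fun k => hxP none k hxA) hbη
  refine hasDirDeriv_add_of_coneSet (hwζ.pos_smul ha) fun ε hε => ?_
  obtain ⟨l, hl⟩ := exists_nat_one_div_lt hε
  obtain ⟨j, k, u, huD, hv, hu, hx⟩ := hwη'.exists_mem_coneSet hxA hc
    (closure_minimal hD isClosed_closure (hwη'.mem_closure_span hxA hc))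
    (TopologicalSpace.denseRange_denseSeq (Euc n)) (show 0 < 1 / ((l : ℝ) + 1) by positivity)
  obtain ⟨d, hd⟩ := exists_approxInDir hx (fun m => hxP (some (j, ⟨u, huD⟩, l, k)) m hx) haζ
  refine ⟨V j, u, _, by positivity, hv, hu.trans hl, d, fun t ht => ?_, hd.2⟩
  obtain ⟨hA', hcone⟩ := hd.1 t ht
  exact ⟨hA', fun s hs hsr y hy hys => (hcone s hs hsr y hy hys).trans (by gcongr)⟩
end
end

section
/- Let X be a real normed space, A ⊆ ℝⁿ Lebesgue measurable, f : A → X Lipschitz, and x ∈ A ∩ D(A). Then f is differentiable at x (that is, there exists a continuous linear map L : ℝⁿ → X with ‖f(x + h) − f(x) − L(h)‖/‖h‖ → 0 as h → 0 with x + h ∈ A, h ≠ 0) if and only if: (1) f is differentiable at x in every direction ζ ∈ ℝⁿ \ {0}, and (2) the map ζ ↦ ∂⁺f(x, ζ) (extended by 0 at ζ = 0) is additive and positively homogeneous, i.e. ∂⁺f(x, ζ + η) = ∂⁺f(x, ζ) + ∂⁺f(x, η) and ∂⁺f(x, aζ) = a·∂⁺f(x, ζ) for all nonzero ζ, η and a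 > 0. -/
open MeasureTheory Filter Metric Set Topology

noncomputable section

/-- If a ball of radius `ε t` around `x + t ζ` misses `A`, then `A` occupies at most a fixed
proportion, smaller than one, of the ball of radius `t (‖ζ‖ + 1)` around `x`. -/
lemma volume_inter_ball_div_le {n : ℕ} {A : Set (Euc n)} {x ζ : Euc n} {t ε : ℝ}
    (ht : 0 < t) (hε : 0 < ε) (hε1 : ε ≤ 1)
    (hdisj : Disjoint (ball (x + t • ζ) (t * ε)) A) :
    volume (A ∩ ball x (t * (‖ζ‖ + 1))) / volume (ball x (t * (‖ζ‖ + 1))) ≤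
      1 - ENNReal.ofReal ((ε / (‖ζ‖ + 1)) ^ n) := by
  have hζ : 0 < ‖ζ‖ + 1 := by positivity
  have hsub : ball (x + t • ζ) (t * ε) ⊆ ball x (t * (‖ζ‖ + 1)) := by
    apply ball_subset_ball'
    rw [dist_eq_norm, add_sub_cancel_left, norm_smul, Real.norm_of_nonneg ht.le]
    nlinarith
  have hpos : volume (ball x (t * (‖ζ‖ + 1))) ≠ 0 := (measure_ball_pos _ _ (by positivity)).ne'
  have hvol : volume (ball (x + t • ζ) (t * ε)) =
      ENNReal.ofReal ((ε / (‖ζ‖ + 1)) ^ n) * volume (ball x (t * (‖ζ‖ + 1))) := by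
    have hr : t * ε = ε / (‖ζ‖ + 1) * (t * (‖ζ‖ + 1)) := by field_simp
    rw [hr, Measure.addHaar_ball_mul_of_pos _ _ (by positivity), finrank_euclideanSpace_fin,
      Measure.addHaar_ball_center volume x]
  have hle : volume (A ∩ ball x (t * (‖ζ‖ + 1))) ≤
      (1 - ENNReal.ofReal ((ε / (‖ζ‖ + 1)) ^ n)) * volume (ball x (t * (‖ζ‖ + 1))) := by
    calc volume (A ∩ ball x (t * (‖ζ‖ + 1)))
        ≤ volume (ball x (t * (‖ζ‖ + 1)) \ ball (x + t • ζ) (t * ε)) :=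
          measure_mono fun y hy => ⟨hy.2, fun hy' => hdisj.notMem_of_mem_left hy' hy.1⟩
      _ = volume (ball x (t * (‖ζ‖ + 1))) - volume (ball (x + t • ζ) (t * ε)) :=
          measure_sdiff hsub measurableSet_ball.nullMeasurableSet measure_ball_lt_top.ne
      _ = _ := by
          rw [hvol, ENNReal.sub_mul fun _ _ => measure_ball_lt_top.ne, one_mul]
  exact ENNReal.div_le_of_le_mul hle

/-- At a density point of `A`, the distance from `x + t ζ` to `A` is `o(t)`. -/
lemma DensityPoint.tendsto_infDist_div {n : ℕ} {A : Set (Euc n)} {x : Euc n}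
    (hd : DensityPoint A x) (ζ : Euc n) :
    Tendsto (fun t : ℝ => infDist (x + t • ζ) A / t) (𝓝[>] (0 : ℝ)) (𝓝 0) := by
  rw [Metric.tendsto_nhds]
  intro ε hε
  set ε' := min ε 1
  have hε' : 0 < ε' := lt_min hε one_pos
  have hζ : 0 < ‖ζ‖ + 1 := by positivity
  have hscale : Tendsto (fun t : ℝ => t * (‖ζ‖ + 1)) (𝓝[>] (0 : ℝ)) (𝓝[>] (0 : ℝ)) := by
    refine tendsto_nhdsWithin_iff.2 ⟨?_, ?_⟩
    · have : Tendsto (fun t : ℝ => t * (‖ζ‖ + 1)) (𝓝 0) (𝓝 (0 * (‖ζ‖ + 1))) :=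
        tendsto_id.mul_const _
      rw [zero_mul] at this
      exact this.mono_left nhdsWithin_le_nhds
    · filter_upwards [self_mem_nhdsWithin] with t ht
      exact mul_pos ht hζ
  have hlt : 1 - ENNReal.ofReal ((ε' / (‖ζ‖ + 1)) ^ n) < 1 :=
    ENNReal.sub_lt_self ENNReal.one_ne_top one_ne_zero
      (ENNReal.ofReal_pos.2 (by positivity)).ne'
  filter_upwards [(hd.comp hscale).eventually_const_lt hlt, self_mem_nhdsWithin] with t hlt' ht
  have ht : 0 < t := ht
  rw [Real.dist_0_eq_abs, abs_of_nonneg (div_nonneg infDist_nonneg ht.le), div_lt_iff₀ ht]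
  by_contra! hcon
  refine (volume_inter_ball_div_le ht hε' (min_le_right _ _) ?_).not_gt hlt'
  refine Disjoint.mono_left (ball_subset_ball ?_) disjoint_ball_infDist
  exact le_trans (by rw [mul_comm]; gcongr; exact min_le_left _ _) hcon

/-- At a density point of `A` belonging to `A`, every direction is approximated in `A`. -/
lemma DensityPoint.exists_approxInDir {n : ℕ} {A : Set (Euc n)} {x : Euc n}
    (hd : DensityPoint A x) (hne : A.Nonempty) (ζ : Euc n) :
    ∃ c : ℝ → Euc n, ApproxInDir A x ζ c := by
  have hex : ∀ t : ℝ, ∃ y ∈ A, 0 < t → dist (x + t • ζ) y < infDist (x + t • ζ) A + t * t := by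
    intro t
    by_cases ht : 0 < t
    · obtain ⟨y, hy, h⟩ := (infDist_lt_iff hne).1
        (lt_add_of_pos_right (infDist (x + t • ζ) A) (mul_pos ht ht))
      exact ⟨y, hy, fun _ => h⟩
    · exact ⟨hne.some, hne.some_mem, fun h => absurd h ht⟩
  choose y hyA hy using hex
  refine ⟨fun t => y t - x, fun t _ => by simpa using hyA t, ?_⟩
  have hbound : Tendsto (fun t : ℝ => infDist (x + t • ζ) A / t + t) (𝓝[>] (0 : ℝ)) (𝓝 0) := by
    simpa using (hd.tendsto_infDist_div ζ).add
      (tendsto_id.mono_left (nhdsWithin_le_nhds (a := (0 : ℝ)) (s := Ioi 0)))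
  refine tendsto_of_tendsto_of_tendsto_of_le_of_le' tendsto_const_nhds hbound ?_ ?_
  · filter_upwards [self_mem_nhdsWithin] with t ht
    exact div_nonneg (norm_nonneg _) (le_of_lt ht)
  · filter_upwards [self_mem_nhdsWithin] with t ht
    have ht : 0 < t := ht
    have hdist : ‖y t - x - t • ζ‖ = dist (x + t • ζ) (y t) := by
      rw [dist_comm, dist_eq_norm, sub_sub]
    rw [div_le_iff₀ ht, add_mul, div_mul_cancel₀ _ ht.ne', hdist]
    exact (hy t ht).le

lemma ApproxInDir.tendsto_inv_smul {n : ℕ} {A : Set (Euc n)} {x ζ : Euc n} {c : ℝ → Euc n}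
    (hc : ApproxInDir A x ζ c) :
    Tendsto (fun t : ℝ => t⁻¹ • c t) (𝓝[>] (0 : ℝ)) (𝓝 ζ) := by
  rw [tendsto_iff_norm_sub_tendsto_zero]
  refine hc.2.congr' ?_
  filter_upwards [self_mem_nhdsWithin] with t ht
  have ht : 0 < t := ht
  rw [div_eq_inv_mul, ← Real.norm_of_nonneg (inv_nonneg.2 ht.le), ← norm_smul, smul_sub,
    inv_smul_smul₀ ht.ne', Real.norm_of_nonneg (inv_nonneg.2 ht.le)]

lemma hasFDerivWithinAt_iff_tendsto_norm_div {E X : Type*} [NormedAddCommGroup E]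
    [NormedSpace ℝ E] [NormedAddCommGroup X] [NormedSpace ℝ X] {A : Set E} {f : E → X} {x : E}
    {L : E →L[ℝ] X} :
    HasFDerivWithinAt f L A x ↔
      Tendsto (fun h : E => ‖f (x + h) - f x - L h‖ / ‖h‖)
        (𝓝[{h : E | x + h ∈ A ∧ h ≠ 0}] 0) (𝓝 0) := by
  have hset : {h : E | x + h ∈ A ∧ h ≠ 0} = (x + ·) ⁻¹' (A \ {x}) := by
    ext h; simp
  have hmap : map (x + ·) (𝓝[(x + ·) ⁻¹' (A \ {x})] (0 : E)) = 𝓝[A \ {x}] x := by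
    simpa using (Homeomorph.addLeft x).isOpenEmbedding.map_nhdsWithin_preimage_eq (A \ {x}) (0 : E)
  rw [← hasFDerivWithinAt_sdiff_singleton x, hasFDerivWithinAt_iff_tendsto, hset, ← hmap,
    tendsto_map'_iff]
  simp [Function.comp_def, div_eq_inv_mul]

/-- A Lipschitz map with linear directional derivatives, in directions that are all approximated
in the domain, is differentiable. -/
lemma tendsto_norm_div_of_hasDirDeriv {n : ℕ} {X : Type*} [NormedAddCommGroup X]
    [NormedSpace ℝ X] {A : Set (Euc n)} {f : Euc n → X} {K : NNReal} (hf : LipschitzOnWith K f A)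
    {x : Euc n} (happ : ∀ ζ : Euc n, ∃ c : ℝ → Euc n, ApproxInDir A x ζ c)
    {L : Euc n →L[ℝ] X} (hL : ∀ ζ : Euc n, ζ ≠ 0 → HasDirDeriv A f x ζ (L ζ)) :
    Tendsto (fun h : Euc n => ‖f (x + h) - f x - L h‖ / ‖h‖)
      (𝓝[{h : Euc n | x + h ∈ A ∧ h ≠ 0}] 0) (𝓝 0) := by
  rw [tendsto_iff_ultrafilter]
  intro U hU
  have hmem : ∀ᶠ h in (U : Filter (Euc n)), x + h ∈ A ∧ h ≠ 0 :=
    hU self_mem_nhdsWithin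
  have hnorm : Tendsto (fun h : Euc n => ‖h‖) U (𝓝[>] (0 : ℝ)) := by
    refine tendsto_nhdsWithin_iff.2
      ⟨tendsto_norm_zero.mono_left (hU.trans nhdsWithin_le_nhds), ?_⟩
    filter_upwards [hmem] with h hh
    exact norm_pos_iff.2 hh.2
  obtain ⟨ζ, hζ, hUζ⟩ := (isCompact_sphere (0 : Euc n) 1).ultrafilter_le_nhds
    (U.map fun h => ‖h‖⁻¹ • h) (by
      rw [le_principal_iff, Ultrafilter.mem_coe, Ultrafilter.mem_map]
      filter_upwards [hmem] with h hh
      simp [norm_smul, hh.2])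
  have hdir : Tendsto (fun h : Euc n => ‖h‖⁻¹ • h) U (𝓝 ζ) := hUζ
  have hζ0 : ζ ≠ 0 := ne_zero_of_mem_unit_sphere ⟨ζ, hζ⟩
  obtain ⟨c, hc⟩ := happ ζ
  have hderiv := ((hL ζ hζ0 c hc).comp hnorm).sub ((L.continuous.tendsto ζ).comp hdir)
  have hclose := (hdir.sub (hc.tendsto_inv_smul.comp hnorm)).norm.const_mul (K : ℝ)
  have hbound := hclose.add hderiv.norm
  simp only [sub_self, norm_zero, mul_zero, add_zero] at hbound
  refine tendsto_of_tendsto_of_tendsto_of_le_of_le' tendsto_const_nhds hbound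
    (Eventually.of_forall fun h => by positivity) ?_
  filter_upwards [hmem] with h hh
  have hpos : 0 < ‖h‖ := norm_pos_iff.2 hh.2
  have hlip : ‖f (x + h) - f (x + c ‖h‖)‖ ≤ K * ‖h - c ‖h‖‖ := by
    simpa using hf.norm_sub_le hh.1 (hc.1 _ hpos)
  simp only [Function.comp_apply, map_smul, ← smul_sub]
  rw [norm_smul, norm_smul, norm_inv, norm_norm, div_eq_inv_mul, mul_left_comm, ← mul_add]
  gcongr
  calc ‖f (x + h) - f x - L h‖
      = ‖(f (x + h) - f (x + c ‖h‖)) + (f (x + c ‖h‖) - f x - L h)‖ := by congr 1; abel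
    _ ≤ _ := (norm_add_le _ _).trans (by gcongr)

/-- At a density point of the domain, a Lipschitz map is differentiable iff it is
differentiable in every nonzero direction and the directional derivative map
(extended by `0` at `0`) is additive and positively homogeneous. -/
theorem stmt10 {n : ℕ} {X : Type*} [NormedAddCommGroup X] [NormedSpace ℝ X]
    (A : Set (Euc n)) (hA : NullMeasurableSet A volume)
    (f : Euc n → X) (K : NNReal) (hf : LipschitzOnWith K f A)
    (x : Euc n) (hx : x ∈ A) (hd : DensityPoint A x) :
    (∃ L : Euc n →L[ℝ] X,
        Tendsto (fun h : Euc n => ‖f (x + h) - f x - L h‖ / ‖h‖)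
          (𝓝[{h : Euc n | x + h ∈ A ∧ h ≠ 0}] 0) (𝓝 0)) ↔
    (∃ D : Euc n → X, D 0 = 0 ∧
        (∀ ζ : Euc n, ζ ≠ 0 → HasDirDeriv A f x ζ (D ζ)) ∧
        (∀ ζ η : Euc n, D (ζ + η) = D ζ + D η) ∧
        (∀ a : ℝ, 0 < a → ∀ ζ : Euc n, D (a • ζ) = a • D ζ)) := by
  constructor
  · rintro ⟨L, hL⟩
    exact ⟨L, map_zero L,
      fun ζ _ => (hasFDerivWithinAt_iff_tendsto_norm_div.2 hL).hasDirDeriv ζ,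
      map_add L, fun a _ ζ => map_smul L a ζ⟩
  · rintro ⟨D, hD0, hD, hadd, hsmul⟩
    have hneg : ∀ ζ, D (-ζ) = -D ζ := (AddMonoidHom.mk' D hadd).map_neg
    let L : Euc n →ₗ[ℝ] X :=
      { toFun := D
        map_add' := hadd
        map_smul' := fun a ζ => by
          rcases lt_trichotomy a 0 with ha | rfl | ha
          · have h := hsmul (-a) (neg_pos.2 ha) (-ζ)
            rwa [neg_smul_neg, hneg, neg_smul_neg] at h
          · simp [hD0]
          · exact hsmul a ha ζ }
    exact ⟨LinearMap.toContinuousLinearMap L,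
      tendsto_norm_div_of_hasDirDeriv hf (hd.exists_approxInDir ⟨x, hx⟩) hD⟩
end
end

section
/- Let X be a real normed space, A ⊆ ℝⁿ Lebesgue measurable, f : A → X Lipschitz and x ∈ A ∩ D(A). Assume that ∂⁺f(x, ζ) exists for every ζ ∈ ℝⁿ \ {0} and that the map ζ ↦ ∂⁺f(x, ζ) (extended by 0 at 0) is additive and positively homogeneous. Let (t, ζ) ↦ ζ_x^t(ζ) ∈ ℝⁿ be any assignment such that x + ζ_x^t(ζ) ∈ A for all t > 0 and all ζ with 0 < ‖ζ‖ ≤ 1, and sup_{0<‖ζ‖≤1} ‖ζ_x^t(ζ) − tζ‖/t → 0 as t ↓ 0. Then sup_{0<‖ζ‖≤1} ‖(f(x + ζ_x^t(ζ)) − f(x))/t − ∂⁺f(x, ζ)‖ → 0 as t ↓ 0, i.e. the difference quotients converge to the directional derivatives uniformly over directions in the closed unit ball. -/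
open MeasureTheory Filter Metric Set Topology

noncomputable section

/-- An additive, positively homogeneous map on a finite-dimensional space is bounded. -/
theorem exists_norm_le_of_additive_of_posHomogeneous {E X : Type*} [NormedAddCommGroup E]
    [NormedSpace ℝ E] [FiniteDimensional ℝ E] [NormedAddCommGroup X] [NormedSpace ℝ X]
    (D : E → X) (hadd : ∀ u v, D (u + v) = D u + D v)
    (hsmul : ∀ a : ℝ, 0 < a → ∀ v, D (a • v) = a • D v) :
    ∃ M : ℝ, 0 ≤ M ∧ ∀ u v, ‖D u - D v‖ ≤ M * ‖u - v‖ := by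
  let φ : E →+ X := AddMonoidHom.mk' D hadd
  let L : E →ₗ[ℝ] X :=
    { toFun := φ
      map_add' := φ.map_add
      map_smul' := fun a v => by
        simp only [RingHom.id_apply]
        rcases lt_trichotomy a 0 with ha | rfl | ha
        · have h : φ ((-a) • v) = (-a) • φ v := hsmul (-a) (by linarith) v
          rw [neg_smul, neg_smul, map_neg] at h
          exact neg_injective h
        · simp
        · exact hsmul a ha v }
  refine ⟨‖LinearMap.toContinuousLinearMap L‖, norm_nonneg _, fun u v => ?_⟩
  have h := (LinearMap.toContinuousLinearMap L).le_opNorm (u - v)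
  rwa [map_sub] at h

/-- If the directional derivatives of a Lipschitz map exist at a density point of the
domain in all nonzero directions and define an additive, positively homogeneous map,
then the difference quotients converge uniformly over directions in the unit ball. -/
theorem stmt17 {n : ℕ} {X : Type*} [NormedAddCommGroup X] [NormedSpace ℝ X]
    (A : Set (Euc n)) (hA : NullMeasurableSet A volume)
    (f : Euc n → X) (K : NNReal) (hf : LipschitzOnWith K f A)
    (x : Euc n) (hx : x ∈ A) (hd : DensityPoint A x)
    (D : Euc n → X) (hD0 : D 0 = 0)
    (hder : ∀ ζ : Euc n, ζ ≠ 0 → HasDirDeriv A f x ζ (D ζ))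
    (haddD : ∀ ζ η : Euc n, D (ζ + η) = D ζ + D η)
    (hhomD : ∀ a : ℝ, 0 < a → ∀ ζ : Euc n, D (a • ζ) = a • D ζ)
    (c : ℝ → Euc n → Euc n)
    (hmem : ∀ t > (0:ℝ), ∀ ζ : Euc n, 0 < ‖ζ‖ → ‖ζ‖ ≤ 1 → x + c t ζ ∈ A)
    (happrox : ∀ ε > (0:ℝ), ∃ δ > (0:ℝ), ∀ t : ℝ, 0 < t → t < δ →
      ∀ ζ : Euc n, 0 < ‖ζ‖ → ‖ζ‖ ≤ 1 → ‖c t ζ - t • ζ‖ / t < ε) :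
    ∀ ε > (0:ℝ), ∃ δ > (0:ℝ), ∀ t : ℝ, 0 < t → t < δ →
      ∀ ζ : Euc n, 0 < ‖ζ‖ → ‖ζ‖ ≤ 1 →
        ‖t⁻¹ • (f (x + c t ζ) - f x) - D ζ‖ < ε := by
  intro ε hε
  obtain ⟨M, hM, hDM⟩ := exists_norm_le_of_additive_of_posHomogeneous D haddD hhomD
  have hK : (0 : ℝ) ≤ K := K.2
  have hP : 0 < (K : ℝ) + M + 1 := by positivity
  obtain ⟨η, hη, hηε⟩ : ∃ η : ℝ, 0 < η ∧ η * (4 * ((K : ℝ) + M + 1)) = ε :=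
    ⟨ε / (4 * ((K : ℝ) + M + 1)), by positivity, by field_simp⟩
  have htb : TotallyBounded {ζ : Euc n | 0 < ‖ζ‖ ∧ ‖ζ‖ ≤ 1} :=
    (isCompact_closedBall (0 : Euc n) 1).totallyBounded.subset
      fun ζ hζ => mem_closedBall_zero_iff.2 hζ.2
  obtain ⟨S, hS, hSfin, hcover⟩ := Metric.finite_approx_of_totallyBounded htb η hη
  have hconv : ∀ᶠ t in 𝓝[>] (0 : ℝ), ∀ s ∈ S,
      ‖t⁻¹ • (f (x + c t s) - f x) - D s‖ < ε / 4 := by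
    rw [Filter.eventually_all_finite hSfin]
    intro s hs
    have hlim := hder s (norm_pos_iff.1 (hS hs).1) (fun t => c t s)
      ⟨fun t ht => hmem t ht s (hS hs).1 (hS hs).2, by
        refine Metric.tendsto_nhdsWithin_nhds.2 fun e he => ?_
        obtain ⟨δ, hδ, h⟩ := happrox e he
        refine ⟨δ, hδ, fun t (ht : 0 < t) htδ => ?_⟩
        rw [Real.dist_0_eq_abs, abs_of_pos ht] at htδ
        rw [Real.dist_0_eq_abs, abs_of_nonneg (by positivity)]
        exact h t ht htδ s (hS hs).1 (hS hs).2⟩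
    filter_upwards [Metric.tendsto_nhds.1 hlim (ε / 4) (by positivity)] with t ht
    rwa [dist_eq_norm] at ht
  obtain ⟨δ₁, hδ₁, hconv⟩ := mem_nhdsGT_iff_exists_Ioo_subset.1 hconv
  obtain ⟨δ₂, hδ₂, happ⟩ := happrox η hη
  refine ⟨min δ₁ δ₂, lt_min hδ₁ hδ₂, fun t ht htδ ζ hζ hζ1 => ?_⟩
  obtain ⟨s, hs, hζs⟩ := mem_iUnion₂.1 (hcover ⟨hζ, hζ1⟩)
  rw [mem_ball, dist_eq_norm] at hζs
  have h1 := hconv ⟨ht, htδ.trans_le (min_le_left _ _)⟩ s hs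
  have htδ₂ := htδ.trans_le (min_le_right δ₁ δ₂)
  have h2 := (div_lt_iff₀ ht).1 (happ t ht htδ₂ ζ hζ hζ1)
  have h3 := (div_lt_iff₀ ht).1 (happ t ht htδ₂ s (hS hs).1 (hS hs).2)
  have hc : ‖c t ζ - c t s‖ ≤ 3 * η * t := by
    have e : c t ζ - c t s = (c t ζ - t • ζ) + t • (ζ - s) - (c t s - t • s) := by
      rw [smul_sub]; abel
    have h4 : ‖t • (ζ - s)‖ ≤ η * t := by
      rw [norm_smul, Real.norm_of_nonneg ht.le, mul_comm]
      gcongr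
    rw [e]
    linarith [norm_sub_le ((c t ζ - t • ζ) + t • (ζ - s)) (c t s - t • s),
      norm_add_le (c t ζ - t • ζ) (t • (ζ - s))]
  have hquot : ‖t⁻¹ • (f (x + c t ζ) - f (x + c t s))‖ ≤ K * (3 * η) := by
    have h5 := hf.norm_sub_le (hmem t ht ζ hζ hζ1) (hmem t ht s (hS hs).1 (hS hs).2)
    rw [add_sub_add_left_eq_sub] at h5
    rw [norm_smul, norm_inv, Real.norm_of_nonneg ht.le, inv_mul_le_iff₀ ht]
    calc _ ≤ K * ‖c t ζ - c t s‖ := h5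
      _ ≤ K * (3 * η * t) := by gcongr
      _ = _ := by ring
  have hD : ‖D s - D ζ‖ ≤ M * η := by
    refine (hDM s ζ).trans ?_
    rw [norm_sub_rev]
    gcongr
  have e : t⁻¹ • (f (x + c t ζ) - f x) - D ζ = t⁻¹ • (f (x + c t ζ) - f (x + c t s)) +
      (t⁻¹ • (f (x + c t s) - f x) - D s) + (D s - D ζ) := by
    simp only [smul_sub]; abel
  rw [e]
  refine (norm_add₃_le).trans_lt ?_
  nlinarith [mul_nonneg hM hη.le]
end
end
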